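/- arXiv:2110.04680 — 2 statements merged into one kernel-verified Lean document; each statement's English description precedes it below -/
import Mathlib

section
/- Let a ≥ 1 and let c₁, c₂ : (−d,d) → ℝ be an arc-length meridian parametrization of the ellipse x² = a²(1−z²) (i.e. c₂(0) = 0, c₁ > 0, c₂' > 0, c₁'² + c₂'² = 1 and c₁² = a²(1 − c₂²)) with c₁ twice differentiable. Then c₁'(r)² − c₁(r)c₁''(r) − 1 ≥ 0 for all r ∈ (−d,d); moreover, if a > 1 then the inequality is strict. In fact, c₁'(r)² − c₁(r)c₁''(r) − 1 = (a² − 1) c₁(r)⁴ / (c₁(r)² + a⁴c₂(r)²)². -/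
/-- On the ellipse `x² = a²(1 - z²)`, the first- and second-order consequences of the ellipse and
arc-length equations determine the quantity `p² - x s - 1`, where `p = x'`, `q = z'`, `s = x''`. -/
theorem ellipse_sq_sub_mul_sub_one {a x z p q q' s : ℝ} (hx : 0 < x) (hq : 0 < q)
    (harc : p ^ 2 + q ^ 2 = 1) (harc' : p * s + q * q' = 0)
    (hell' : x * p + a ^ 2 * (z * q) = 0)
    (hell'' : p * p + x * s + a ^ 2 * (q * q + z * q') = 0) :
    p ^ 2 - x * s - 1
      = (a ^ 2 - 1) * x ^ 4 / (x ^ 2 + a ^ 4 * z ^ 2) ^ 2 := by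
  have hD : 0 < x ^ 2 + a ^ 4 * z ^ 2 := by positivity
  have hqD : q ^ 2 * (x ^ 2 + a ^ 4 * z ^ 2) = x ^ 2 := by
    linear_combination x ^ 2 * harc - (x * p - a ^ 2 * (z * q)) * hell'
  have hsD : s * (x ^ 2 + a ^ 4 * z ^ 2) = -x * (p ^ 2 + a ^ 2 * q ^ 2) := by
    apply mul_left_cancel₀ hq.ne'
    linear_combination q * x * hell'' - a ^ 2 * z * x * harc' + a ^ 2 * z * s * hell'
  rw [eq_div_iff (by positivity)]
  linear_combination (-x * (x ^ 2 + a ^ 4 * z ^ 2)) * hsD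
    + (x ^ 2 + a ^ 4 * z ^ 2) * (x ^ 2 + a ^ 4 * z ^ 2) * harc
    + x ^ 2 * (x ^ 2 + a ^ 4 * z ^ 2) * harc
    + ((a ^ 2 - 1) * x ^ 2 - (x ^ 2 + a ^ 4 * z ^ 2)) * hqD

/-- [TTconj, Prop. 4.1]: for an arc-length meridian parametrization of the
ellipse `x² = a²(1-z²)` with `a ≥ 1`, the quantity `c₁'² - c₁c₁'' - 1` is
nonnegative, strictly positive when `a > 1`, and in fact equals
`(a² - 1)c₁⁴/(c₁² + a⁴c₂²)²`. -/
theorem stmt_8 (a d : ℝ) (ha : 1 ≤ a) (hd : 0 < d)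
    (c₁ c₂ : ℝ → ℝ)
    (hc₁diff : ∀ r ∈ Set.Ioo (-d) d, DifferentiableAt ℝ c₁ r)
    (hc₁'diff : ∀ r ∈ Set.Ioo (-d) d, DifferentiableAt ℝ (deriv c₁) r)
    (hc₂diff : ∀ r ∈ Set.Ioo (-d) d, DifferentiableAt ℝ c₂ r)
    (hc₂0 : c₂ 0 = 0)
    (hc₁pos : ∀ r ∈ Set.Ioo (-d) d, 0 < c₁ r)
    (hc₂' : ∀ r ∈ Set.Ioo (-d) d, 0 < deriv c₂ r)
    (harc : ∀ r ∈ Set.Ioo (-d) d, (deriv c₁ r) ^ 2 + (deriv c₂ r) ^ 2 = 1)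
    (hell : ∀ r ∈ Set.Ioo (-d) d, (c₁ r) ^ 2 = a ^ 2 * (1 - (c₂ r) ^ 2)) :
    ∀ r ∈ Set.Ioo (-d) d,
      (deriv c₁ r) ^ 2 - c₁ r * deriv (deriv c₁) r - 1
          = (a ^ 2 - 1) * (c₁ r) ^ 4 / ((c₁ r) ^ 2 + a ^ 4 * (c₂ r) ^ 2) ^ 2 ∧
      0 ≤ (deriv c₁ r) ^ 2 - c₁ r * deriv (deriv c₁) r - 1 ∧
      (1 < a → 0 < (deriv c₁ r) ^ 2 - c₁ r * deriv (deriv c₁) r - 1) := by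
  intro r hr
  have hnhds : Set.Ioo (-d) d ∈ nhds r := isOpen_Ioo.mem_nhds hr
  have hell' : ∀ t ∈ Set.Ioo (-d) d, c₁ t * deriv c₁ t + a ^ 2 * (c₂ t * deriv c₂ t) = 0 := by
    intro t ht
    have h₁ := (hc₁diff t ht).hasDerivAt.pow 2
    have h₂ := (((hc₂diff t ht).hasDerivAt.pow 2).const_sub 1).const_mul (a ^ 2)
    have h := h₁.unique (h₂.congr_of_eventuallyEq
      (Filter.eventually_of_mem (isOpen_Ioo.mem_nhds ht) hell))
    norm_num at h
    linear_combination h / 2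
  have hp := (hc₁'diff r hr).hasDerivAt
  have hq : DifferentiableAt ℝ (deriv c₂) r := by
    have hne : 1 - deriv c₁ r ^ 2 ≠ 0 := by nlinarith [harc r hr, hc₂' r hr]
    refine (((hc₁'diff r hr).pow 2).const_sub 1 |>.sqrt hne).congr_of_eventuallyEq
      (Filter.eventually_of_mem hnhds fun t ht => ?_)
    have h : 1 - deriv c₁ t ^ 2 = deriv c₂ t ^ 2 := by linear_combination -harc t ht
    simp [h, Real.sqrt_sq (hc₂' t ht).le]
  have harc' : deriv c₁ r * deriv (deriv c₁) r + deriv c₂ r * deriv (deriv c₂) r = 0 := by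
    have h := ((hp.pow 2).add (hq.hasDerivAt.pow 2)).unique
      ((hasDerivAt_const r (1 : ℝ)).congr_of_eventuallyEq (Filter.eventually_of_mem hnhds harc))
    norm_num at h
    linear_combination h / 2
  have hell'' := (((hc₁diff r hr).hasDerivAt.mul hp).add
      (((hc₂diff r hr).hasDerivAt.mul hq.hasDerivAt).const_mul (a ^ 2))).unique
    ((hasDerivAt_const r (0 : ℝ)).congr_of_eventuallyEq (Filter.eventually_of_mem hnhds hell'))
  have hx := hc₁pos r hr
  have key := ellipse_sq_sub_mul_sub_one hx (hc₂' r hr) (harc r hr) harc' (hell' r hr) hell''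
  refine ⟨key, ?_, fun ha' => ?_⟩
  · rw [key]
    have : 0 ≤ a ^ 2 - 1 := by nlinarith
    positivity
  · rw [key]
    have : 0 < a ^ 2 - 1 := by nlinarith
    positivity
end

section
/- Let a > 0 and let c₁, c₂ : (−d,d) → ℝ be continuously differentiable functions satisfying c₂(0) = 0, c₁(r) > 0, c₂'(r) > 0, c₁'(r)² + c₂'(r)² = 1, and c₁(r)² = a²(1 − c₂(r)²) for all r ∈ (−d,d). Then c₂ is an odd function and c₁ is an even function: c₂(−r) = −c₂(r) and c₁(−r) = c₁(r) for all r ∈ (−d,d). -/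
open Set

/-- The arc-length density, with respect to the height `z`, of the meridian of the ellipse
`x² = a²(1-z²)`. -/
noncomputable def arcDensity (a z : ℝ) : ℝ := √((1 - z ^ 2 + a ^ 2 * z ^ 2) / (1 - z ^ 2))

/-- The signed arc length along the meridian from height `0` to height `z`. -/
noncomputable def arcLength (a z : ℝ) : ℝ := ∫ t in (0 : ℝ)..z, arcDensity a t

theorem one_sub_sq_pos {z : ℝ} (hz : z ∈ Ioo (-1 : ℝ) 1) : 0 < 1 - z ^ 2 := by
  nlinarith [hz.1, hz.2]

theorem continuousOn_arcDensity (a : ℝ) : ContinuousOn (arcDensity a) (Ioo (-1) 1) := by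
  unfold arcDensity
  refine ContinuousOn.sqrt (ContinuousOn.div (by fun_prop) (by fun_prop) ?_)
  exact fun z hz => (one_sub_sq_pos hz).ne'

theorem arcDensity_pos (a : ℝ) {z : ℝ} (hz : z ∈ Ioo (-1 : ℝ) 1) : 0 < arcDensity a z := by
  have := one_sub_sq_pos hz
  unfold arcDensity
  positivity

theorem arcDensity_neg (a z : ℝ) : arcDensity a (-z) = arcDensity a z := by
  simp [arcDensity]

theorem arcLength_neg (a z : ℝ) : arcLength a (-z) = -arcLength a z := by
  have h := intervalIntegral.integral_comp_neg (a := 0) (b := z) (arcDensity a)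
  simp only [arcDensity_neg, neg_zero] at h
  rw [arcLength, arcLength, h, intervalIntegral.integral_symm]

theorem hasDerivAt_arcLength (a : ℝ) {z : ℝ} (hz : z ∈ Ioo (-1 : ℝ) 1) :
    HasDerivAt (arcLength a) (arcDensity a z) z := by
  have hsub : uIcc 0 z ⊆ Ioo (-1) 1 :=
    ordConnected_Ioo.uIcc_subset (by norm_num) hz
  have hmeas : Measurable (arcDensity a) := by
    unfold arcDensity
    fun_prop
  exact intervalIntegral.integral_hasDerivAt_right
    ((continuousOn_arcDensity a).mono hsub).intervalIntegrable
    hmeas.stronglyMeasurable.stronglyMeasurableAtFilter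
    ((continuousOn_arcDensity a).continuousAt (isOpen_Ioo.mem_nhds hz))

theorem strictMonoOn_arcLength (a : ℝ) : StrictMonoOn (arcLength a) (Ioo (-1) 1) := by
  refine strictMonoOn_of_deriv_pos (convex_Ioo _ _)
    (fun z hz => (hasDerivAt_arcLength a hz).continuousAt.continuousWithinAt) fun z hz => ?_
  rw [interior_Ioo] at hz
  rw [(hasDerivAt_arcLength a hz).deriv]
  exact arcDensity_pos a hz

/-- Along an upward unit-speed motion on the ellipse, the density is the inverse of the vertical
speed. -/
theorem arcDensity_mul_eq_one {a x z p q : ℝ} (ha : 0 < a) (hz : 0 < 1 - z ^ 2) (hp : 0 < p)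
    (hunit : q ^ 2 + p ^ 2 = 1) (hell : x ^ 2 = a ^ 2 * (1 - z ^ 2))
    (htan : x * q = -(a ^ 2 * (z * p))) : arcDensity a z * p = 1 := by
  have hsq : a ^ 2 * ((1 - z ^ 2) * (1 - p ^ 2)) = a ^ 2 * (a ^ 2 * z ^ 2 * p ^ 2) := by
    have : x ^ 2 * q ^ 2 = a ^ 4 * (z ^ 2 * p ^ 2) := by
      linear_combination (x * q - a ^ 2 * (z * p)) * htan
    rw [hell, show q ^ 2 = 1 - p ^ 2 by linarith] at this
    linear_combination this
  have hp2 := mul_left_cancel₀ (by positivity) hsq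
  have : (1 - z ^ 2 + a ^ 2 * z ^ 2) / (1 - z ^ 2) = p⁻¹ ^ 2 := by
    field_simp
    linear_combination -hp2
  rw [arcDensity, this, Real.sqrt_sq (by positivity), inv_mul_cancel₀ hp.ne']


/-- Symmetry of the arc-length meridian parametrization of the ellipse
`x² = a²(1-z²)`: the height coordinate `c₂` is odd and the radius `c₁` is even. -/
theorem stmt_11 (a d : ℝ) (ha : 0 < a) (hd : 0 < d)
    (c₁ c₂ : ℝ → ℝ)
    (hc₁ : ContDiffOn ℝ 1 c₁ (Set.Ioo (-d) d))
    (hc₂ : ContDiffOn ℝ 1 c₂ (Set.Ioo (-d) d))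
    (hc₂0 : c₂ 0 = 0)
    (hc₁pos : ∀ r ∈ Set.Ioo (-d) d, 0 < c₁ r)
    (hc₂' : ∀ r ∈ Set.Ioo (-d) d, 0 < deriv c₂ r)
    (harc : ∀ r ∈ Set.Ioo (-d) d, (deriv c₁ r) ^ 2 + (deriv c₂ r) ^ 2 = 1)
    (hell : ∀ r ∈ Set.Ioo (-d) d, (c₁ r) ^ 2 = a ^ 2 * (1 - (c₂ r) ^ 2)) :
    ∀ r ∈ Set.Ioo (-d) d, c₂ (-r) = -c₂ r ∧ c₁ (-r) = c₁ r := by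
  have hz : ∀ r ∈ Ioo (-d) d, 0 < 1 - c₂ r ^ 2 := fun r hr =>
    pos_of_mul_pos_right (hell r hr ▸ pow_pos (hc₁pos r hr) 2) (sq_nonneg a)
  have hmem : ∀ r ∈ Ioo (-d) d, c₂ r ∈ Ioo (-1 : ℝ) 1 := fun r hr =>
    abs_lt.mp ((sq_lt_one_iff_abs_lt_one _).mp (by linarith [hz r hr]))
  have hderiv {f : ℝ → ℝ} (hf : ContDiffOn ℝ 1 f (Ioo (-d) d)) {r : ℝ} (hr : r ∈ Ioo (-d) d) :
      HasDerivAt f (deriv f r) r :=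
    ((hf.differentiableOn one_ne_zero).differentiableAt (isOpen_Ioo.mem_nhds hr)).hasDerivAt
  have htan : ∀ r ∈ Ioo (-d) d, c₁ r * deriv c₁ r = -(a ^ 2 * (c₂ r * deriv c₂ r)) := by
    intro r hr
    have h₁ := (hderiv hc₁ hr).fun_pow 2
    have h₂ := (((hderiv hc₂ hr).fun_pow 2).const_sub 1).const_mul (a ^ 2)
    have heq : (fun r => c₁ r ^ 2) =ᶠ[nhds r] fun r => a ^ 2 * (1 - c₂ r ^ 2) :=
      Filter.eventually_of_mem (isOpen_Ioo.mem_nhds hr) hell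
    have h := h₁.unique (h₂.congr_of_eventuallyEq heq)
    norm_num at h
    linear_combination h / 2
  have hg : ∀ r ∈ Ioo (-d) d, HasDerivAt (fun r => arcLength a (c₂ r) - r) 0 r := by
    intro r hr
    have h := ((hasDerivAt_arcLength a (hmem r hr)).comp r (hderiv hc₂ hr)).sub (hasDerivAt_id r)
    rwa [arcDensity_mul_eq_one ha (hz r hr) (hc₂' r hr) (harc r hr) (hell r hr) (htan r hr),
      sub_self] at h
  have hlen : ∀ r ∈ Ioo (-d) d, arcLength a (c₂ r) = r := by
    intro r hr
    have h := isOpen_Ioo.is_const_of_deriv_eq_zero isPreconnected_Ioo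
      (fun s hs => (hg s hs).differentiableAt.differentiableWithinAt)
      (fun s hs => (hg s hs).deriv) hr (show (0 : ℝ) ∈ Ioo (-d) d from ⟨by linarith, hd⟩)
    simp only [hc₂0, arcLength, intervalIntegral.integral_same, sub_zero] at h
    exact sub_eq_zero.mp h
  intro r hr
  have hr' : -r ∈ Ioo (-d) d := ⟨by linarith [hr.2], by linarith [hr.1]⟩
  have hodd : c₂ (-r) = -c₂ r := by
    have hneg : -c₂ r ∈ Ioo (-1 : ℝ) 1 :=
      ⟨by linarith [(hmem r hr).2], by linarith [(hmem r hr).1]⟩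
    apply (strictMonoOn_arcLength a).injOn (hmem _ hr') hneg
    rw [arcLength_neg, hlen _ hr', hlen r hr]
  refine ⟨hodd, (sq_eq_sq₀ (hc₁pos _ hr').le (hc₁pos r hr).le).mp ?_⟩
  rw [hell _ hr', hell r hr, hodd, neg_sq]
end
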